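/- Let p be an odd prime and let G be a finite group whose commutator subgroup [G,G] has order 2p. Then the order of the abelianization G/[G,G] is divisible by 4. -/

import Mathlib

/-- A normal subgroup of order two is central. -/
theorem le_center_of_card_eq_two {G : Type*} [Group G] (N : Subgroup G) [hN : N.Normal]
    (h : Nat.card N = 2) : N ≤ Subgroup.center G := by
  intro z hz
  rw [Subgroup.mem_center_iff]
  intro g
  by_cases hz1 : z = 1
  · simp [hz1]
  obtain ⟨w, -, hw⟩ := (Nat.card_eq_two_iff' (1 : N)).mp h
  have hzw := hw ⟨z, hz⟩ (by simpa [Subtype.ext_iff] using hz1)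
  have hcw := hw ⟨g * z * g⁻¹, hN.conj_mem z hz g⟩ (by simpa [Subtype.ext_iff] using hz1)
  have key : g * z * g⁻¹ = z := congrArg Subtype.val (hcw.trans hzw.symm)
  exact mul_inv_eq_iff_eq_mul.mp key

open scoped commutatorElement in
/-- If the commutator subgroup has order two, then every square is central. -/
theorem sq_mem_center_of_card_commutator_eq_two {G : Type*} [Group G]
    (h : Nat.card (commutator G) = 2) (g : G) : g ^ 2 ∈ Subgroup.center G := by
  rw [Subgroup.mem_center_iff]
  intro k
  have hmem : ⁅g, k⁆ ∈ commutator G :=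
    Subgroup.commutator_mem_commutator (Subgroup.mem_top g) (Subgroup.mem_top k)
  have hcen := Subgroup.mem_center_iff.mp (le_center_of_card_eq_two _ h hmem)
  have hsq : ⁅g, k⁆ ^ 2 = 1 := by
    have := pow_card_eq_one' (x := (⟨⁅g, k⁆, hmem⟩ : commutator G))
    rw [h] at this
    simpa [Subtype.ext_iff] using this
  have hgk : g * k = ⁅g, k⁆ * (k * g) := by simp [commutatorElement_def, mul_assoc]
  symm
  calc g ^ 2 * k = g * (g * k) := by rw [pow_two, mul_assoc]
    _ = g * ⁅g, k⁆ * (k * g) := by rw [hgk, mul_assoc]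
    _ = ⁅g, k⁆ * (g * k) * g := by rw [hcen g]; simp only [mul_assoc]
    _ = ⁅g, k⁆ ^ 2 * (k * g ^ 2) := by rw [hgk]; simp only [pow_two, mul_assoc]
    _ = k * g ^ 2 := by rw [hsq, one_mul]

/-- If the commutator subgroup of a finite group has order two, then its index is divisible by
four. -/
theorem four_dvd_index_commutator_of_card_eq_two {G : Type*} [Group G] [Finite G]
    (h : Nat.card (commutator G) = 2) : 4 ∣ (commutator G).index := by
  refine dvd_trans ?_ (Subgroup.index_dvd_of_le (le_center_of_card_eq_two _ h))
  have : Fact (Nat.Prime 2) := ⟨Nat.prime_two⟩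
  have hp : IsPGroup 2 (G ⧸ Subgroup.center G) := by
    intro x
    obtain ⟨g, rfl⟩ := QuotientGroup.mk_surjective x
    refine ⟨1, ?_⟩
    rw [pow_one, ← QuotientGroup.mk_pow, QuotientGroup.eq_one_iff]
    exact sq_mem_center_of_card_commutator_eq_two h g
  obtain ⟨n, hn⟩ := IsPGroup.iff_card.mp hp
  have hnc : ¬ IsCyclic (G ⧸ Subgroup.center G) := by
    intro hc
    have hcomm : IsMulCommutative G :=
      (QuotientGroup.mk' (Subgroup.center G)).isMulCommutative_of_isCyclic_of_ker_le_center
        (by simp)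
    rw [(commutator_eq_bot_iff G).mpr hcomm, Subgroup.card_bot] at h
    omega
  rw [Subgroup.index_eq_card, hn]
  match n with
  | 0 =>
    rw [pow_zero, Nat.card_eq_one_iff_unique] at hn
    have := hn.1
    exact absurd isCyclic_of_subsingleton hnc
  | 1 => exact absurd (isCyclic_of_prime_card (p := 2) (by simpa using hn)) hnc
  | n + 2 => exact ⟨2 ^ n, by ring⟩

/-- A group of order `2p`, with `p` an odd prime, has a characteristic subgroup of index two. -/
theorem exists_characteristic_index_eq_two {N : Type*} [Group N] {p : ℕ} (hp : p.Prime)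
    (hodd : Odd p) (hN : Nat.card N = 2 * p) :
    ∃ P : Subgroup N, P.Characteristic ∧ P.index = 2 := by
  have : Fact p.Prime := ⟨hp⟩
  have : Finite N := Nat.finite_of_card_ne_zero (by have := hp.pos; omega)
  have hp2 : ¬ p ∣ 2 := fun h ↦ by
    have := (Nat.prime_dvd_prime_iff_eq hp Nat.prime_two).mp h
    subst this
    exact absurd hodd (by decide)
  obtain ⟨P⟩ : Nonempty (Sylow p N) := inferInstance
  have hcard : Nat.card P = p := by
    rw [P.card_eq_multiplicity, hN, Nat.factorization_mul two_ne_zero hp.ne_zero]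
    simp [Nat.factorization_eq_zero_of_not_dvd hp2, hp.factorization_self]
  have hidx : (P : Subgroup N).index = 2 := by
    have := (P : Subgroup N).card_mul_index
    rw [hN, hcard, mul_comm] at this
    exact Nat.eq_of_mul_eq_mul_right hp.pos this
  exact ⟨P, P.characteristic_of_normal (Subgroup.normal_of_index_eq_two hidx), hidx⟩

/-- If the commutator subgroup of a finite group `G` has order `2p` for an odd prime `p`,
then the order of the abelianization `G/[G,G]` is divisible by `4`. -/
theorem stmt18 {G : Type*} [Group G] [Fintype G]
    (p : ℕ) (hp : p.Prime) (hodd : Odd p)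
    (hcomm : Nat.card (commutator G) = 2 * p) :
    4 ∣ Nat.card (G ⧸ commutator G) := by
  obtain ⟨P, hchar, hidx⟩ := exists_characteristic_index_eq_two hp hodd hcomm
  let f := QuotientGroup.mk' (P.map (commutator G).subtype)
  have hf : Function.Surjective f := QuotientGroup.mk'_surjective _
  have hker : f.ker = P.map (commutator G).subtype := QuotientGroup.ker_mk' _
  have hle : f.ker ≤ commutator G := hker.trans_le (Subgroup.map_subtype_le P)
  have hmap : (commutator G).map f = commutator (G ⧸ P.map (commutator G).subtype) := by
    rw [map_commutator_eq, MonoidHom.range_eq_top.mpr hf, ← commutator_def]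
  have hcard : Nat.card ((commutator G).map f) = 2 := by
    rw [← Subgroup.relIndex_ker, hker, ← hidx, Subgroup.relIndex, Subgroup.subgroupOf,
      Subgroup.comap_map_eq_self_of_injective (commutator G).subtype_injective]
  rw [← Subgroup.index_eq_card, ← Subgroup.index_map_eq (commutator G) hf hle, hmap]
  exact four_dvd_index_commutator_of_card_eq_two (hmap ▸ hcard)
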